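/- Let k ⊆ K be a field extension and let I ⊆ k[x_0,...,x_n] be a homogeneous ideal. Then I is generated by a homogeneous regular sequence in k[x_0,...,x_n] if and only if the extended ideal I·K[x_0,...,x_n] is generated by a homogeneous regular sequence in K[x_0,...,x_n]. In other words, the property of being a complete intersection is stable under extension of the ground field. -/

import Mathlib

open MvPolynomial

/-- A homogeneous ideal of a polynomial ring: one that contains all homogeneous
components of its elements. -/
def IsHomogeneousIdeal {k : Type*} [CommRing k] {σ : Type*} (I : Ideal (MvPolynomial σ k)) :
    Prop :=
  ∀ f ∈ I, ∀ d : ℕ, MvPolynomial.homogeneousComponent d f ∈ I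

/-- An ideal is a complete intersection if it is generated by a homogeneous
regular sequence. -/
def IsHomogeneousCompleteIntersection {k : Type*} [CommRing k] {σ : Type*}
    (I : Ideal (MvPolynomial σ k)) : Prop :=
  ∃ rs : List (MvPolynomial σ k), (∀ f ∈ rs, ∃ d : ℕ, f.IsHomogeneous d) ∧
    RingTheory.Sequence.IsRegular (MvPolynomial σ k) rs ∧ Ideal.ofList rs = I

open RingTheory.Sequence

section HomogeneousIdeals

attribute [local instance] MvPolynomial.gradedAlgebra

theorem isHomogeneousIdeal_ofList {k σ : Type*} [CommRing k] {rs : List (MvPolynomial σ k)}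
    (hrs : ∀ f ∈ rs, ∃ d : ℕ, f.IsHomogeneous d) : IsHomogeneousIdeal (Ideal.ofList rs) :=
  fun _ hf d => homogeneousComponent_mem_of_mem
    (Ideal.homogeneous_span (homogeneousSubmodule σ k) _ hrs) hf d

/-- The component of degree `d` of a multiple `b * h` of a form `h` of degree `d`. -/
theorem MvPolynomial.IsHomogeneous.homogeneousComponent_mul_self {k σ : Type*} [CommRing k]
    {h : MvPolynomial σ k} {d : ℕ} (hh : h.IsHomogeneous d) (b : MvPolynomial σ k) :
    homogeneousComponent d (b * h) = C (constantCoeff b) * h := by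
  have key := DirectSum.coe_decompose_mul_add_of_right_mem (homogeneousSubmodule σ k)
    (i := 0) (a := b) (b := h) hh
  rw [zero_add] at key
  have hdec (p : MvPolynomial σ k) (i : ℕ) :
      (DirectSum.decompose (homogeneousSubmodule σ k) p i : MvPolynomial σ k) =
        homogeneousComponent i p := decomposition.decompose'_apply p i
  rwa [hdec, hdec, homogeneousComponent_zero] at key

end HomogeneousIdeals

theorem IsHomogeneousIdeal.span_homogeneous_eq {k σ : Type*} [CommRing k]
    {I : Ideal (MvPolynomial σ k)} (hI : IsHomogeneousIdeal I) :
    Ideal.span {f | f ∈ I ∧ ∃ d : ℕ, f.IsHomogeneous d} = I := by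
  refine le_antisymm (Ideal.span_le.2 fun f hf => hf.1) fun f hf => ?_
  rw [← sum_homogeneousComponent f]
  exact Ideal.sum_mem _ fun d _ =>
    Ideal.subset_span ⟨hI f hf d, d, homogeneousComponent_isHomogeneous d f⟩

theorem MvPolynomial.homogeneousComponent_pow_mul_eq_zero {k σ : Type*} [CommRing k]
    {a : MvPolynomial σ k} (ha : constantCoeff a = 0) {d n : ℕ} (hdn : d < n)
    (y : MvPolynomial σ k) : homogeneousComponent d (a ^ n * y) = 0 := by
  have key (n : ℕ) : ∀ m : σ →₀ ℕ, m.degree < n → coeff m (a ^ n * y) = 0 := by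
    classical
    induction n with
    | zero => simp
    | succ n ih =>
      intro m hm
      rw [pow_succ', mul_assoc, coeff_mul]
      refine Finset.sum_eq_zero fun p hp => ?_
      rw [Finset.HasAntidiagonal.mem_antidiagonal] at hp
      by_cases h0 : p.1 = 0
      · rw [h0, ← constantCoeff_eq, ha, zero_mul]
      · have hpos : 0 < p.1.degree := Nat.pos_of_ne_zero (by rwa [Ne, Finsupp.degree_eq_zero_iff])
        rw [← hp, map_add] at hm
        rw [ih p.2 (by lia), mul_zero]
  ext m
  rw [coeff_homogeneousComponent, coeff_zero]
  split_ifs with hm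
  · exact key n m (hm ▸ hdn)
  · rfl

/-- A homogeneous ideal is closed in the adic topology of a polynomial without constant term. -/
theorem IsHomogeneousIdeal.mem_of_forall_exists_sub_pow_mul_mem {k σ : Type*} [CommRing k]
    {J : Ideal (MvPolynomial σ k)} (hJ : IsHomogeneousIdeal J) {a x : MvPolynomial σ k}
    (ha : constantCoeff a = 0) (hx : ∀ n : ℕ, ∃ y, x - a ^ n * y ∈ J) : x ∈ J := by
  rw [← sum_homogeneousComponent x]
  refine Ideal.sum_mem _ fun d _ => ?_
  obtain ⟨y, hy⟩ := hx (d + 1)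
  simpa [homogeneousComponent_pow_mul_eq_zero ha d.lt_succ_self] using hJ _ hy d

theorem isSMulRegular_quotient_ideal_smul_top_iff {R : Type*} [CommRing R] (J : Ideal R) (r : R) :
    IsSMulRegular (R ⧸ (J • ⊤ : Submodule R R)) r ↔ ∀ x, r * x ∈ J → x ∈ J := by
  rw [isSMulRegular_quotient_iff_mem_of_smul_mem]
  simp

theorem isWeaklyRegular_concat_iff {R : Type*} [CommRing R] (rs : List R) (r : R) :
    IsWeaklyRegular R (rs ++ [r]) ↔
      IsWeaklyRegular R rs ∧ ∀ x, r * x ∈ Ideal.ofList rs → x ∈ Ideal.ofList rs := by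
  rw [isWeaklyRegular_append_iff, isWeaklyRegular_singleton_iff,
    isSMulRegular_quotient_ideal_smul_top_iff]

theorem Ideal.ofList_perm {R : Type*} [CommRing R] {rs rs' : List R} (h : rs.Perm rs') :
    Ideal.ofList rs = Ideal.ofList rs' :=
  congrArg Ideal.span <| Set.ext fun _ => h.mem_iff

/-- Weakly regular sequences of forms of positive degree may be permuted. -/
theorem RingTheory.Sequence.IsWeaklyRegular.perm_of_isHomogeneous {k σ : Type*} [CommRing k]
    {rs rs' : List (MvPolynomial σ k)} (h : IsWeaklyRegular (MvPolynomial σ k) rs)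
    (hrs : ∀ f ∈ rs, ∃ d : ℕ, f.IsHomogeneous d) (hc : ∀ f ∈ rs, constantCoeff f = 0)
    (hp : rs.Perm rs') : IsWeaklyRegular (MvPolynomial σ k) rs' := by
  refine h.prototype_perm hp fun a b t hsub => ?_
  intro N hN
  have hJ : IsHomogeneousIdeal (Ideal.ofList t) :=
    isHomogeneousIdeal_ofList fun f hf => hrs f (hsub.subset (by simp [hf]))
  have ha : constantCoeff a = 0 := hc a (hsub.subset (by simp))
  have hpow (n : ℕ) : ∀ z ∈ N, ∃ y ∈ N, z = a ^ n • y := by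
    induction n with
    | zero => exact fun z hz => ⟨z, hz, by simp⟩
    | succ n ih =>
      intro z hz
      obtain ⟨y, hy, rfl⟩ := ih z hz
      rw [hN] at hy
      obtain ⟨w, hw, rfl⟩ := (Submodule.mem_smul_pointwise_iff_exists _ _ _).1 hy
      exact ⟨w, hw, by rw [pow_succ, mul_smul]⟩
  refine (Submodule.eq_bot_iff _).2 fun z hz => ?_
  obtain ⟨x, rfl⟩ := Submodule.mkQ_surjective _ z
  rw [Submodule.mkQ_apply, Submodule.Quotient.mk_eq_zero, smul_eq_mul, Ideal.mul_top]
  refine hJ.mem_of_forall_exists_sub_pow_mul_mem ha fun n => ?_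
  obtain ⟨y, -, hy⟩ := hpow n _ hz
  obtain ⟨y, rfl⟩ := Submodule.mkQ_surjective _ y
  refine ⟨y, ?_⟩
  rw [← map_smul, ← sub_eq_zero, ← map_sub, Submodule.mkQ_apply, Submodule.Quotient.mk_eq_zero,
    smul_eq_mul, smul_eq_mul, Ideal.mul_top] at hy
  exact hy

theorem constantCoeff_eq_zero_of_mem_ofList {k σ : Type*} [CommRing k]
    {rs : List (MvPolynomial σ k)} (hc : ∀ f ∈ rs, constantCoeff f = 0) {f : MvPolynomial σ k}
    (hf : f ∈ Ideal.ofList rs) : constantCoeff f = 0 :=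
  (Ideal.span_le (I := RingHom.ker constantCoeff)).2 hc hf

/-- A form in a proper ideal of a polynomial ring over a field has no constant term. -/
theorem MvPolynomial.IsHomogeneous.constantCoeff_eq_zero_of_mem {k σ : Type*} [Field k]
    {f : MvPolynomial σ k} {d : ℕ} (hf : f.IsHomogeneous d) {J : Ideal (MvPolynomial σ k)}
    (hJ : J ≠ ⊤) (hfJ : f ∈ J) : constantCoeff f = 0 := by
  by_contra hne
  have hd : d = 0 := by simpa using (hf (d := 0) hne).symm
  subst hd
  have hfC : f = C (constantCoeff f) := by
    rw [← homogeneousComponent_eq_self hf, homogeneousComponent_zero]; simp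
  rw [hfC] at hfJ
  exact hJ (J.eq_top_of_isUnit_mem hfJ ((isUnit_iff_ne_zero.2 hne).map C))

/-- If a form `h` is a nonzerodivisor modulo a homogeneous ideal `Q` without constant terms, then
in every set of forms generating `Q + (h)` some form can take the place of `h`. -/
theorem exists_eq_C_mul_add_of_span_eq {k σ : Type*} [Field k]
    {Q : Ideal (MvPolynomial σ k)} (hQ : IsHomogeneousIdeal Q)
    (hQc : ∀ f ∈ Q, constantCoeff f = 0) {h : MvPolynomial σ k} {d : ℕ} (hh : h.IsHomogeneous d)
    (hreg : ∀ x, h * x ∈ Q → x ∈ Q) {G : Set (MvPolynomial σ k)}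
    (hG : ∀ g ∈ G, ∃ e : ℕ, g.IsHomogeneous e) (hspan : Ideal.span G = Q ⊔ Ideal.span {h}) :
    ∃ g ∈ G, ∃ c : k, c ≠ 0 ∧ ∃ q ∈ Q, g = q + C c * h := by
  obtain ⟨g, hgG, hg⟩ : ∃ g ∈ G, g ∉ Q ⊔ Ideal.span {h} * RingHom.ker constantCoeff := by
    by_contra! hall
    have hmem : h ∈ Q ⊔ Ideal.span {h} * RingHom.ker constantCoeff :=
      Ideal.span_le.2 hall (hspan ▸ Ideal.mem_sup_right (Ideal.mem_span_singleton_self h))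
    obtain ⟨q, hq, z, hz, hqz⟩ := Submodule.mem_sup.1 hmem
    obtain ⟨b, hb, rfl⟩ := Ideal.mem_span_singleton_mul.1 hz
    have h1 := hQc _ (hreg (1 - b) (by
      rw [show h * (1 - b) = q by linear_combination -hqz]; exact hq))
    rw [RingHom.mem_ker] at hb
    simp [hb] at h1
  obtain ⟨q, hq, z, hz, hqz⟩ := Submodule.mem_sup.1 (hspan ▸ Ideal.subset_span hgG)
  obtain ⟨b, rfl⟩ := Ideal.mem_span_singleton'.1 hz
  have hb : constantCoeff b ≠ 0 := fun hb => hg <| hqz ▸ Submodule.add_mem_sup hq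
    (Ideal.mem_span_singleton_mul.2 ⟨b, hb, mul_comm _ _⟩)
  have hcomp : homogeneousComponent d g =
      homogeneousComponent d q + C (constantCoeff b) * h := by
    rw [← hqz, map_add, hh.homogeneousComponent_mul_self]
  obtain ⟨e, he⟩ := hG g hgG
  rw [homogeneousComponent_of_mem he] at hcomp
  split_ifs at hcomp
  · exact ⟨g, hgG, _, hb, _, hQ q hq d, hcomp⟩
  · have hhQ : h ∈ Q := by
      have : C (constantCoeff b) * h ∈ Q := by
        rw [show C (constantCoeff b) * h = -homogeneousComponent d q by linear_combination -hcomp]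
        exact Q.neg_mem (hQ q hq d)
      exact (Ideal.unit_mul_mem_iff_mem Q ((isUnit_iff_ne_zero.2 hb).map C)).1 this
    exact absurd (Ideal.mem_sup_left (hqz ▸ Q.add_mem hq (Q.mul_mem_left b hhQ))) hg

/-- Exchange property: if an ideal is generated by a regular sequence of forms, then every set of
forms generating it contains a regular sequence generating it. -/
theorem exists_isRegular_subset_of_span_eq {k σ : Type*} [Field k]
    {J : Ideal (MvPolynomial σ k)} (hJ : IsHomogeneousCompleteIntersection J)
    {G : Set (MvPolynomial σ k)} (hG : ∀ g ∈ G, ∃ e : ℕ, g.IsHomogeneous e)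
    (hspan : Ideal.span G = J) :
    ∃ rs : List (MvPolynomial σ k), (∀ f ∈ rs, f ∈ G) ∧
      IsRegular (MvPolynomial σ k) rs ∧ Ideal.ofList rs = J := by
  obtain ⟨rs, hhom, hreg, hrs⟩ := hJ
  have hJtop : J ≠ ⊤ := by
    have := hreg.top_ne_smul
    rw [hrs, smul_eq_mul, Ideal.mul_top] at this
    exact this.symm
  suffices H : ∀ t s : List (MvPolynomial σ k), (∀ f ∈ s, f ∈ G) →
      (∀ f ∈ t, ∃ d : ℕ, f.IsHomogeneous d) → IsWeaklyRegular (MvPolynomial σ k) (s ++ t) →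
      Ideal.ofList (s ++ t) = J →
      ∃ rs : List (MvPolynomial σ k), (∀ f ∈ rs, f ∈ G) ∧
        IsWeaklyRegular (MvPolynomial σ k) rs ∧ Ideal.ofList rs = J by
    obtain ⟨rs', hG', hw, hJ'⟩ := H rs [] (by simp) hhom hreg.toIsWeaklyRegular hrs
    refine ⟨rs', hG', ⟨hw, ?_⟩, hJ'⟩
    rw [hJ', smul_eq_mul, Ideal.mul_top]
    exact hJtop.symm
  intro t
  induction t with
  | nil => exact fun s hs _ hw hsJ => ⟨s, hs, by simpa using hw, by simpa using hsJ⟩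
  | cons h t ih =>
    intro s hs ht hw hsJ
    have hhom' : ∀ f ∈ s ++ t, ∃ d : ℕ, f.IsHomogeneous d := fun f hf =>
      (List.mem_append.1 hf).elim (fun hf => hG f (hs f hf)) fun hf => ht f (by simp [hf])
    obtain ⟨d, hd⟩ := ht h (by simp)
    have hperm (g : MvPolynomial σ k) : (s ++ g :: t).Perm ((s ++ t) ++ [g]) :=
      List.perm_middle.trans (List.perm_append_singleton g (s ++ t)).symm
    have hmemJ (f) (hf : f ∈ s ++ h :: t) : f ∈ J := hsJ ▸ Ideal.subset_span hf
    have hc : ∀ f ∈ s ++ t, constantCoeff f = 0 := fun f hf => by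
      obtain ⟨e, he⟩ := hhom' f hf
      exact he.constantCoeff_eq_zero_of_mem hJtop (hmemJ f (by simp at hf ⊢; tauto))
    have hhc : constantCoeff h = 0 := hd.constantCoeff_eq_zero_of_mem hJtop (hmemJ h (by simp))
    have hw' := IsWeaklyRegular.perm_of_isHomogeneous hw
      (fun f hf => by
        rcases List.mem_append.1 ((hperm h).mem_iff.1 hf) with hf | hf
        · exact hhom' f hf
        · exact ⟨d, by simpa [List.mem_singleton.1 hf] using hd⟩)
      (fun f hf => by
        rcases List.mem_append.1 ((hperm h).mem_iff.1 hf) with hf | hf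
        · exact hc f hf
        · rwa [List.mem_singleton.1 hf]) (hperm h)
    rw [isWeaklyRegular_concat_iff] at hw'
    have hsup (g : MvPolynomial σ k) :
        Ideal.ofList (s ++ t ++ [g]) = Ideal.ofList (s ++ t) ⊔ Ideal.span {g} := by
      rw [Ideal.ofList_append, Ideal.ofList_singleton]
    have hJsup : J = Ideal.ofList (s ++ t) ⊔ Ideal.span {h} := by
      rw [← hsJ, Ideal.ofList_perm (hperm h), hsup]
    obtain ⟨g, hgG, c, hc0, q, hq, hg⟩ := exists_eq_C_mul_add_of_span_eq
      (isHomogeneousIdeal_ofList hhom') (fun f => constantCoeff_eq_zero_of_mem_ofList hc) hd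
      hw'.2 hG (hspan.trans hJsup)
    have hcu : IsUnit (C c : MvPolynomial σ k) := (isUnit_iff_ne_zero.2 hc0).map C
    have hgJ : Ideal.ofList (s ++ t ++ [g]) = J := by
      rw [hsup, hJsup]
      refine le_antisymm (sup_le le_sup_left ?_) (sup_le le_sup_left ?_)
      · rw [Ideal.span_singleton_le_iff_mem, hg]
        exact Submodule.add_mem_sup hq
          (Ideal.mul_mem_left _ _ (Ideal.mem_span_singleton_self h))
      · rw [Ideal.span_singleton_le_iff_mem, ← Ideal.unit_mul_mem_iff_mem _ hcu,
          show C c * h = -q + g by rw [hg]; ring]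
        exact Submodule.add_mem_sup (neg_mem hq) (Ideal.mem_span_singleton_self g)
    have hgw : IsWeaklyRegular (MvPolynomial σ k) (s ++ t ++ [g]) := by
      refine (isWeaklyRegular_concat_iff _ _).2 ⟨hw'.1, fun x hx => hw'.2 x ?_⟩
      rw [← Ideal.unit_mul_mem_iff_mem _ hcu,
        show C c * (h * x) = g * x - x * q by rw [hg]; ring]
      exact sub_mem hx (Ideal.mul_mem_left _ _ hq)
    obtain ⟨e, he⟩ := hG g hgG
    have hgc : constantCoeff g = 0 := he.constantCoeff_eq_zero_of_mem hJtop
      (hspan ▸ Ideal.subset_span hgG)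
    have hperm' : (s ++ t ++ [g]).Perm ((s ++ [g]) ++ t) := by
      simpa using (hperm g).symm
    refine ih (s ++ [g]) ?_ (fun f hf => ht f (by simp [hf])) ?_ ?_
    · simpa [or_imp, forall_and, hgG] using hs
    · refine IsWeaklyRegular.perm_of_isHomogeneous hgw (fun f hf => ?_) (fun f hf => ?_) hperm'
      · rcases List.mem_append.1 hf with hf | hf
        · exact hhom' f hf
        · exact ⟨e, by simpa [List.mem_singleton.1 hf] using he⟩
      · rcases List.mem_append.1 hf with hf | hf
        · exact hc f hf
        · rwa [List.mem_singleton.1 hf]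
    · rw [← hgJ, Ideal.ofList_perm hperm']

theorem RingTheory.Sequence.IsRegular.of_map_of_faithfullyFlat {R S : Type*}
    [CommRing R] [CommRing S] [Algebra R S] [Module.FaithfullyFlat R S] {rs : List R}
    (h : IsRegular S (rs.map (algebraMap R S))) :
    IsRegular R rs := by
  have hcomap (J : Ideal R) (x : R) :
      algebraMap R S x ∈ J.map (algebraMap R S) ↔ x ∈ J := by
    rw [← Ideal.mem_comap, Ideal.comap_map_eq_self_of_faithfullyFlat]
  refine ⟨⟨fun i hi => ?_⟩, fun htop => h.top_ne_smul ?_⟩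
  · rw [isSMulRegular_quotient_ideal_smul_top_iff]
    intro x hx
    have hreg := h.regular_mod_prev i (by simpa using hi)
    rw [isSMulRegular_quotient_ideal_smul_top_iff, ← List.map_take, ← Ideal.map_ofList,
      List.getElem_map] at hreg
    refine (hcomap _ x).1 (hreg _ ?_)
    rw [← map_mul]
    exact (hcomap _ _).2 hx
  · rw [smul_eq_mul, Ideal.mul_top] at htop ⊢
    rw [← Ideal.map_ofList, ← htop, Ideal.map_top]

attribute [local instance] MvPolynomial.algebraMvPolynomial

theorem MvPolynomial.faithfullyFlat_of_field (k K σ : Type*) [Field k] [Field K] [Algebra k K] :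
    Module.FaithfullyFlat (MvPolynomial σ k) (MvPolynomial σ K) :=
  have : Module.Free (MvPolynomial σ k) (MvPolynomial σ K) :=
    .of_equiv (Algebra.IsPushout.out (R := k) (S := MvPolynomial σ k) (R' := K)
      (S' := MvPolynomial σ K)).equiv
  inferInstance

/-- **Complete intersections are stable under field extension.**
Let `k ⊆ K` be a field extension and `I ⊆ k[x_0,...,x_n]` a homogeneous ideal.  Then
`I` is generated by a homogeneous regular sequence in `k[x_0,...,x_n]` if and only if
the extended ideal `I·K[x_0,...,x_n]` is generated by a homogeneous regular sequence
in `K[x_0,...,x_n]`. -/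
theorem isHomogeneousCompleteIntersection_map_iff
    (k K : Type*) [Field k] [Field K] [Algebra k K] (n : ℕ)
    (I : Ideal (MvPolynomial (Fin (n + 1)) k)) (hI : IsHomogeneousIdeal I) :
    IsHomogeneousCompleteIntersection I ↔
      IsHomogeneousCompleteIntersection
        (I.map (MvPolynomial.map (algebraMap k K) :
          MvPolynomial (Fin (n + 1)) k →+* MvPolynomial (Fin (n + 1)) K)) := by
  have hff := MvPolynomial.faithfullyFlat_of_field k K (Fin (n + 1))
  constructor
  · rintro ⟨rs, hhom, hreg, rfl⟩
    refine ⟨rs.map (MvPolynomial.map (algebraMap k K)), ?_, hreg.of_faithfullyFlat,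
      (Ideal.map_ofList _ _).symm⟩
    simp only [List.mem_map, forall_exists_index, and_imp, forall_apply_eq_imp_iff₂]
    exact fun f hf => (hhom f hf).imp fun d hd => hd.map _
  · intro h
    obtain ⟨rs, hG, hreg, hrs⟩ := exists_isRegular_subset_of_span_eq h
      (G := MvPolynomial.map (algebraMap k K) '' {f | f ∈ I ∧ ∃ d : ℕ, f.IsHomogeneous d})
      (by
        rintro _ ⟨f, ⟨-, d, hd⟩, rfl⟩
        exact ⟨d, hd.map _⟩)
      (by rw [← Ideal.map_span, hI.span_homogeneous_eq])
    obtain ⟨rs, hrsI, rfl⟩ : ∃ l : List (MvPolynomial (Fin (n + 1)) k),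
        (∀ f ∈ l, f ∈ I ∧ ∃ d : ℕ, f.IsHomogeneous d) ∧
          l.map (MvPolynomial.map (algebraMap k K)) = rs := by
      choose! φ hφ hφ' using hG
      exact ⟨rs.map φ, by simpa using hφ, by
        rw [List.map_map]
        exact (List.map_congr_left hφ').trans (List.map_id _)⟩
    refine ⟨rs, fun f hf => (hrsI f hf).2, IsRegular.of_map_of_faithfullyFlat hreg, ?_⟩
    rw [← Ideal.map_ofList] at hrs
    rw [← Ideal.comap_map_eq_self_of_faithfullyFlat (B := MvPolynomial (Fin (n + 1)) K) I,
      ← Ideal.comap_map_eq_self_of_faithfullyFlat (B := MvPolynomial (Fin (n + 1)) K)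
        (Ideal.ofList rs)]
    exact congrArg _ hrs
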